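/- arXiv:1709.04705 — 2 statements merged into one kernel-verified Lean document; each statement's English description precedes it below -/
import Mathlib

section
/- The Poisson structures Π_0 and Π_1 on ℝ^6 are compatible: for every λ ∈ ℝ, the pencil bracket {f,g}_{(λ)} = {f,g}_1 − λ{f,g}_0 satisfies the Jacobi identity {f,{g,h}_{(λ)}}_{(λ)} + {g,{h,f}_{(λ)}}_{(λ)} + {h,{f,g}_{(λ)}}_{(λ)} = 0 for all smooth f, g, h : ℝ^6 → ℝ. -/
open Matrix

/-- The bracket `{f,g}_Π(p) = Σ_{i,j} Π(p)_{ij} ∂f/∂u_i(p) ∂g/∂u_j(p)` on `ℝ^n` associated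
to a matrix-valued function `P`. -/
noncomputable def mbracket {n : ℕ} (P : (Fin n → ℝ) → Matrix (Fin n) (Fin n) ℝ)
    (f g : (Fin n → ℝ) → ℝ) (p : Fin n → ℝ) : ℝ :=
  ∑ i, ∑ j, P p i j * fderiv ℝ f p (Pi.single i 1) * fderiv ℝ g p (Pi.single j 1)

/-- The `i`-th component of the Hamiltonian vector field of `h` with respect to `P`. -/
noncomputable def hamVF {n : ℕ} (P : (Fin n → ℝ) → Matrix (Fin n) (Fin n) ℝ)
    (h : (Fin n → ℝ) → ℝ) (p : Fin n → ℝ) (i : Fin n) : ℝ :=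
  ∑ j, P p i j * fderiv ℝ h p (Pi.single j 1)

/-- The Lie–Poisson tensor `Π_0` of `e(3)` on `ℝ^6`, in coordinates
`(x_1,x_2,x_3,y_1,y_2,y_3) = (p 0, …, p 5)`. -/
noncomputable def Pi0 (p : Fin 6 → ℝ) : Matrix (Fin 6) (Fin 6) ℝ :=
  !![0,     0,     0,     0,     -p 2,  p 1;
     0,     0,     0,     p 2,   0,     -p 0;
     0,     0,     0,     -p 1,  p 0,   0;
     0,     -p 2,  p 1,   0,     -p 5,  p 4;
     p 2,   0,     -p 0,  p 5,   0,     -p 3;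
     -p 1,  p 0,   0,     -p 4,  p 3,   0]

/-- The second Poisson tensor `Π_1` on `ℝ^6` for the spherical Lagrange top
(`l_3 = 1`, `m_3 = 2`). -/
noncomputable def Pi1 (p : Fin 6 → ℝ) : Matrix (Fin 6) (Fin 6) ℝ :=
  !![0,        p 5 / 2,  -p 4 / 2, 0,   1, 0;
     -p 5 / 2, 0,        p 3 / 2,  -1,  0, 0;
     p 4 / 2,  -p 3 / 2, 0,        0,   0, 0;
     0,        1,        0,        0,   0, 0;
     -1,       0,        0,        0,   0, 0;
     0,        0,        0,        0,   0, 0]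

/-- The pencil bracket `{f,g}_{(λ)} = {f,g}_1 − λ{f,g}_0` on `ℝ^6`. -/
noncomputable def pencilBracket (l : ℝ) (f g : (Fin 6 → ℝ) → ℝ) (p : Fin 6 → ℝ) : ℝ :=
  mbracket Pi1 f g p - l * mbracket Pi0 f g p

/-- The partial derivatives of a bracket, by the product rule. -/
theorem fderiv_mbracket {n : ℕ} {P : (Fin n → ℝ) → Matrix (Fin n) (Fin n) ℝ}
    {g h : (Fin n → ℝ) → ℝ} {p : Fin n → ℝ}
    (hP : ∀ i j, DifferentiableAt ℝ (fun q => P q i j) p)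
    (hg : ContDiff ℝ 2 g) (hh : ContDiff ℝ 2 h) (v : Fin n → ℝ) :
    fderiv ℝ (mbracket P g h) p v =
      (∑ i, ∑ j, fderiv ℝ (fun q => P q i j) p v *
          fderiv ℝ g p (Pi.single i 1) * fderiv ℝ h p (Pi.single j 1))
      + (∑ i, ∑ j, P p i j * fderiv ℝ (fderiv ℝ g) p v (Pi.single i 1) *
          fderiv ℝ h p (Pi.single j 1))
      + ∑ i, ∑ j, P p i j * fderiv ℝ g p (Pi.single i 1) *
          fderiv ℝ (fderiv ℝ h) p v (Pi.single j 1) := by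
  have partial_deriv {f : (Fin n → ℝ) → ℝ} (hf : ContDiff ℝ 2 f) (w : Fin n → ℝ) :
      HasFDerivAt (fun q => fderiv ℝ f q w) ((fderiv ℝ (fderiv ℝ f) p).flip w) p := by
    have hd : DifferentiableAt ℝ (fderiv ℝ f) p :=
      (hf.fderiv_right (m := 1) (by norm_num)).differentiable (by norm_num) p
    simpa using! hd.hasFDerivAt.clm_apply (hasFDerivAt_const w p)
  have key : HasFDerivAt (mbracket P g h) _ p :=
    HasFDerivAt.fun_sum fun i _ => HasFDerivAt.fun_sum fun j _ =>
      ((hP i j).hasFDerivAt.mul (partial_deriv hg (Pi.single i 1))).mul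
        (partial_deriv hh (Pi.single j 1))
  rw [key.fderiv]
  simp only [_root_.sum_apply, ← Finset.sum_add_distrib]
  refine Finset.sum_congr rfl fun i _ => Finset.sum_congr rfl fun j _ => ?_
  simp
  ring

/-- The iterated bracket `{f,{g,h}}` in terms of `hamVF`: a part involving the derivatives of `P`,
and two parts involving the Hessians of `g` and `h`. -/
theorem mbracket_mbracket {n : ℕ} {P : (Fin n → ℝ) → Matrix (Fin n) (Fin n) ℝ}
    {g h : (Fin n → ℝ) → ℝ} {p : Fin n → ℝ}
    (hP : ∀ i j, DifferentiableAt ℝ (fun q => P q i j) p)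
    (hskew : ∀ i j, P p i j = -P p j i)
    (f : (Fin n → ℝ) → ℝ) (hg : ContDiff ℝ 2 g) (hh : ContDiff ℝ 2 h) :
    mbracket P f (mbracket P g h) p =
      (∑ a, ∑ i, ∑ j, (∑ k, P p a k * fderiv ℝ (fun q => P q i j) p (Pi.single k 1)) *
        (fderiv ℝ f p (Pi.single a 1) * fderiv ℝ g p (Pi.single i 1) *
          fderiv ℝ h p (Pi.single j 1)))
      - (∑ k, ∑ i, hamVF P f p k * hamVF P h p i *
          fderiv ℝ (fderiv ℝ g) p (Pi.single k 1) (Pi.single i 1))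
      + ∑ k, ∑ i, hamVF P f p k * hamVF P g p i *
          fderiv ℝ (fderiv ℝ h) p (Pi.single k 1) (Pi.single i 1) := by
  have hX (u : (Fin n → ℝ) → ℝ) (k : Fin n) :
      ∑ a, P p a k * fderiv ℝ u p (Pi.single a 1) = -hamVF P u p k := by
    simp only [hamVF, ← Finset.sum_neg_distrib]
    exact Finset.sum_congr rfl fun a _ => by rw [hskew a k]; ring
  have hG (k : Fin n) :
      ∑ i, ∑ j, P p i j * fderiv ℝ (fderiv ℝ g) p (Pi.single k 1) (Pi.single i 1) *
          fderiv ℝ h p (Pi.single j 1)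
        = ∑ i, hamVF P h p i * fderiv ℝ (fderiv ℝ g) p (Pi.single k 1) (Pi.single i 1) := by
    refine Finset.sum_congr rfl fun i _ => ?_
    rw [hamVF, Finset.sum_mul]
    exact Finset.sum_congr rfl fun j _ => by ring
  have hH (k : Fin n) :
      ∑ i, ∑ j, P p i j * fderiv ℝ g p (Pi.single i 1) *
          fderiv ℝ (fderiv ℝ h) p (Pi.single k 1) (Pi.single j 1)
        = -∑ i, hamVF P g p i * fderiv ℝ (fderiv ℝ h) p (Pi.single k 1) (Pi.single i 1) := by
    rw [Finset.sum_comm, ← Finset.sum_neg_distrib]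
    refine Finset.sum_congr rfl fun j _ => ?_
    rw [← Finset.sum_mul, hX, neg_mul]
  have outer (V : Fin n → ℝ) :
      ∑ a, ∑ k, P p a k * fderiv ℝ f p (Pi.single a 1) * V k = -∑ k, hamVF P f p k * V k := by
    rw [Finset.sum_comm, ← Finset.sum_neg_distrib]
    refine Finset.sum_congr rfl fun k _ => ?_
    rw [← Finset.sum_mul, hX, neg_mul]
  rw [mbracket]
  simp only [fderiv_mbracket hP hg hh, hG, hH, mul_add, Finset.sum_add_distrib]
  rw [outer fun k => ∑ i, hamVF P h p i *
      fderiv ℝ (fderiv ℝ g) p (Pi.single k 1) (Pi.single i 1),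
    outer fun k => -∑ i, hamVF P g p i *
      fderiv ℝ (fderiv ℝ h) p (Pi.single k 1) (Pi.single i 1), sub_eq_add_neg]
  congr 1
  · congr 1
    · refine Finset.sum_congr rfl fun a _ => ?_
      simp only [Finset.mul_sum, Finset.sum_mul]
      rw [Finset.sum_comm]
      refine Finset.sum_congr rfl fun i _ => ?_
      rw [Finset.sum_comm]
      exact Finset.sum_congr rfl fun j _ => Finset.sum_congr rfl fun k _ => by ring
    · simp only [Finset.mul_sum, mul_assoc]
  · simp only [Finset.mul_sum, mul_neg, Finset.sum_neg_distrib, neg_neg, mul_assoc]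

/-- A skew-symmetric differentiable matrix-valued function whose Jacobiator (the Schouten bracket
with itself) vanishes defines a bracket satisfying the Jacobi identity. -/
theorem mbracket_jacobi {n : ℕ} {P : (Fin n → ℝ) → Matrix (Fin n) (Fin n) ℝ}
    {f g h : (Fin n → ℝ) → ℝ} {p : Fin n → ℝ}
    (hP : ∀ i j, DifferentiableAt ℝ (fun q => P q i j) p)
    (hskew : ∀ i j, P p i j = -P p j i)
    (hJ : ∀ a i j,
      (∑ k, P p a k * fderiv ℝ (fun q => P q i j) p (Pi.single k 1))
        + (∑ k, P p i k * fderiv ℝ (fun q => P q j a) p (Pi.single k 1))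
        + ∑ k, P p j k * fderiv ℝ (fun q => P q a i) p (Pi.single k 1) = 0)
    (hf : ContDiff ℝ 2 f) (hg : ContDiff ℝ 2 g) (hh : ContDiff ℝ 2 h) :
    mbracket P f (mbracket P g h) p + mbracket P g (mbracket P h f) p
      + mbracket P h (mbracket P f g) p = 0 := by
  have hessian_symm {u : (Fin n → ℝ) → ℝ} (hu : ContDiff ℝ 2 u) (X Y : Fin n → ℝ) :
      ∑ k, ∑ i, X k * Y i * fderiv ℝ (fderiv ℝ u) p (Pi.single k 1) (Pi.single i 1)
        = ∑ k, ∑ i, Y k * X i * fderiv ℝ (fderiv ℝ u) p (Pi.single k 1) (Pi.single i 1) := by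
    rw [Finset.sum_comm]
    refine Finset.sum_congr rfl fun i _ => Finset.sum_congr rfl fun k _ => ?_
    rw [(hu.contDiffAt.isSymmSndFDerivAt (by simp)).eq, mul_comm (X k)]
  have cyclic : ∀ T : Fin n → Fin n → Fin n → ℝ,
      ∑ a, ∑ i, ∑ j, T a i j = ∑ a, ∑ i, ∑ j, T j a i := fun T => by
    rw [Finset.sum_comm]
    exact Finset.sum_congr rfl fun i _ => Finset.sum_comm
  rw [mbracket_mbracket hP hskew f hg hh, mbracket_mbracket hP hskew g hh hf,
    mbracket_mbracket hP hskew h hf hg, hessian_symm hf (hamVF P g p),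
    hessian_symm hg (hamVF P h p), hessian_symm hh (hamVF P f p)]
  have hzero := Finset.sum_eq_zero fun a (_ : a ∈ Finset.univ) =>
    Finset.sum_eq_zero fun i (_ : i ∈ Finset.univ) =>
    Finset.sum_eq_zero fun j (_ : j ∈ Finset.univ) =>
    mul_eq_zero_of_left (hJ a i j) (fderiv ℝ f p (Pi.single a 1) *
      fderiv ℝ g p (Pi.single i 1) * fderiv ℝ h p (Pi.single j 1))
  simp only [add_mul, Finset.sum_add_distrib] at hzero
  have second := cyclic fun a i j =>
    (∑ k, P p i k * fderiv ℝ (fun q => P q j a) p (Pi.single k 1)) *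
      (fderiv ℝ f p (Pi.single a 1) * fderiv ℝ g p (Pi.single i 1) *
        fderiv ℝ h p (Pi.single j 1))
  have third := cyclic fun a i j =>
    (∑ k, P p a k * fderiv ℝ (fun q => P q i j) p (Pi.single k 1)) *
      (fderiv ℝ h p (Pi.single a 1) * fderiv ℝ f p (Pi.single i 1) *
        fderiv ℝ g p (Pi.single j 1))
  simp only [mul_comm, mul_left_comm] at hzero second third ⊢
  linarith

/-- The matrix-valued function of the pencil bracket. -/
noncomputable def pencil (l : ℝ) (p : Fin 6 → ℝ) : Matrix (Fin 6) (Fin 6) ℝ :=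
  Pi1 p - l • Pi0 p

theorem pencilBracket_eq_mbracket (l : ℝ) (f g : (Fin 6 → ℝ) → ℝ) :
    pencilBracket l f g = mbracket (pencil l) f g := by
  funext p
  simp only [pencilBracket, mbracket, Finset.mul_sum, ← Finset.sum_sub_distrib]
  refine Finset.sum_congr rfl fun i _ => Finset.sum_congr rfl fun j _ => ?_
  simp only [pencil, Matrix.sub_apply, Matrix.smul_apply, smul_eq_mul]
  ring

theorem pencil_eq (l : ℝ) (p : Fin 6 → ℝ) : pencil l p =
    !![0, p 5 / 2, -p 4 / 2, 0, 1 + l * p 2, -l * p 1;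
       -p 5 / 2, 0, p 3 / 2, -1 - l * p 2, 0, l * p 0;
       p 4 / 2, -p 3 / 2, 0, l * p 1, -l * p 0, 0;
       0, 1 + l * p 2, -l * p 1, 0, l * p 5, -l * p 4;
       -1 - l * p 2, 0, l * p 0, -l * p 5, 0, l * p 3;
       l * p 1, -l * p 0, 0, l * p 4, -l * p 3, 0] := by
  ext i j
  fin_cases i <;> fin_cases j <;> simp [pencil, Pi0, Pi1]

/-- The partial derivatives of the entries of the pencil, which is affine. -/
noncomputable def pencilDeriv (l : ℝ) : Fin 6 → Matrix (Fin 6) (Fin 6) ℝ :=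
  ![!![0, 0, 0, 0, 0, 0;
       0, 0, 0, 0, 0, l;
       0, 0, 0, 0, -l, 0;
       0, 0, 0, 0, 0, 0;
       0, 0, l, 0, 0, 0;
       0, -l, 0, 0, 0, 0],
    !![0, 0, 0, 0, 0, -l;
       0, 0, 0, 0, 0, 0;
       0, 0, 0, l, 0, 0;
       0, 0, -l, 0, 0, 0;
       0, 0, 0, 0, 0, 0;
       l, 0, 0, 0, 0, 0],
    !![0, 0, 0, 0, l, 0;
       0, 0, 0, -l, 0, 0;
       0, 0, 0, 0, 0, 0;
       0, l, 0, 0, 0, 0;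
       -l, 0, 0, 0, 0, 0;
       0, 0, 0, 0, 0, 0],
    !![0, 0, 0, 0, 0, 0;
       0, 0, 1 / 2, 0, 0, 0;
       0, -1 / 2, 0, 0, 0, 0;
       0, 0, 0, 0, 0, 0;
       0, 0, 0, 0, 0, l;
       0, 0, 0, 0, -l, 0],
    !![0, 0, -1 / 2, 0, 0, 0;
       0, 0, 0, 0, 0, 0;
       1 / 2, 0, 0, 0, 0, 0;
       0, 0, 0, 0, 0, -l;
       0, 0, 0, 0, 0, 0;
       0, 0, 0, l, 0, 0],
    !![0, 1 / 2, 0, 0, 0, 0;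
       -1 / 2, 0, 0, 0, 0, 0;
       0, 0, 0, 0, 0, 0;
       0, 0, 0, 0, l, 0;
       0, 0, 0, -l, 0, 0;
       0, 0, 0, 0, 0, 0]]

theorem pencil_apply (l : ℝ) (p : Fin 6 → ℝ) (i j : Fin 6) :
    pencil l p i j = pencil l 0 i j + ∑ k, p k * pencilDeriv l k i j := by
  simp only [Fin.sum_univ_six, pencilDeriv, pencil_eq]
  fin_cases i <;> fin_cases j <;> simp <;> ring

theorem hasFDerivAt_pencil (l : ℝ) (p : Fin 6 → ℝ) (i j : Fin 6) :
    HasFDerivAt (fun q => pencil l q i j)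
      (∑ k, pencilDeriv l k i j • ContinuousLinearMap.proj (R := ℝ) (φ := fun _ => ℝ) k) p := by
  rw [funext fun q => pencil_apply l q i j]
  refine HasFDerivAt.const_add _ (HasFDerivAt.fun_sum fun k _ => ?_)
  exact (hasFDerivAt_apply k p).mul_const _

theorem fderiv_pencil (l : ℝ) (p : Fin 6 → ℝ) (k i j : Fin 6) :
    fderiv ℝ (fun q => pencil l q i j) p (Pi.single k 1) = pencilDeriv l k i j := by
  rw [(hasFDerivAt_pencil l p i j).fderiv]
  simp [_root_.sum_apply, Pi.single_apply]

theorem pencil_skew (l : ℝ) (p : Fin 6 → ℝ) (i j : Fin 6) :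
    pencil l p i j = -pencil l p j i := by
  rw [pencil_eq]
  fin_cases i <;> fin_cases j <;> simp <;> ring

set_option maxHeartbeats 2000000 in
theorem pencil_jacobiator (l : ℝ) (p : Fin 6 → ℝ) (a i j : Fin 6) :
    (∑ k, pencil l p a k * pencilDeriv l k i j) + (∑ k, pencil l p i k * pencilDeriv l k j a)
      + ∑ k, pencil l p j k * pencilDeriv l k a i = 0 := by
  simp only [Fin.sum_univ_six, pencilDeriv, pencil_eq]
  fin_cases a <;> fin_cases i <;> fin_cases j <;> simp <;> ring

/-- The Poisson structures `Π_0` and `Π_1` on `ℝ^6` are compatible: every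
pencil bracket `{·,·}_1 − λ{·,·}_0` satisfies the Jacobi identity. -/
theorem Pi0_Pi1_compatible (l : ℝ) (f g h : (Fin 6 → ℝ) → ℝ)
    (hf : ContDiff ℝ (⊤ : ℕ∞) f) (hg : ContDiff ℝ (⊤ : ℕ∞) g) (hh : ContDiff ℝ (⊤ : ℕ∞) h) :
    ∀ p : Fin 6 → ℝ,
      pencilBracket l f (pencilBracket l g h) p
        + pencilBracket l g (pencilBracket l h f) p
        + pencilBracket l h (pencilBracket l f g) p = 0 := by
  intro p
  simp only [pencilBracket_eq_mbracket]
  refine mbracket_jacobi (fun i j => (hasFDerivAt_pencil l p i j).differentiableAt)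
    (pencil_skew l p) (fun a i j => ?_) (hf.of_le ?_) (hg.of_le ?_) (hh.of_le ?_)
  · simp only [fderiv_pencil]
    exact pencil_jacobiator l p a i j
  all_goals exact WithTop.coe_le_coe.2 le_top
end

section
/- The vector field Y on ℝ^6 with components (x_2, −x_1, 0, y_2, −y_1, 0) is bi-Hamiltonian for the pair (Π_0, Π_1): for every p ∈ ℝ^6 and every i = 1,…,6, Y^i(p) = Σ_{j=1}^{6} (Π_0)_{ij}(p)·(∂f_4/∂u_j)(p) = Σ_{j=1}^{6} (Π_1)_{ij}(p)·(∂f_2/∂u_j)(p), where f_4 = y_3 and f_2 = x_1y_1 + x_2y_2 + x_3y_3. -/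
open Matrix

theorem fderiv_coord_apply {n : ℕ} (k : Fin n) (p v : Fin n → ℝ) :
    fderiv ℝ (fun q : Fin n → ℝ => q k) p v = v k := by
  rw [(hasFDerivAt_apply k p).fderiv]
  rfl

theorem fderiv_dot_apply (p v : Fin 6 → ℝ) :
    fderiv ℝ (fun q : Fin 6 → ℝ => q 0 * q 3 + q 1 * q 4 + q 2 * q 5) p v
      = p 0 * v 3 + p 3 * v 0 + (p 1 * v 4 + p 4 * v 1) + (p 2 * v 5 + p 5 * v 2) := by
  have coord (k : Fin 6) := hasFDerivAt_apply (𝕜 := ℝ) (F' := fun _ : Fin 6 => ℝ) k p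
  exact congrArg (· v) ((((coord 0).mul (coord 3)).add ((coord 1).mul (coord 4))).add
    ((coord 2).mul (coord 5))).fderiv

/-- The vector field `Y = (x_2, −x_1, 0, y_2, −y_1, 0)` on `ℝ^6` is
bi-Hamiltonian for `(Π_0, Π_1)`: it is the Hamiltonian vector field of `f_4 = y_3` with
respect to `Π_0` and of `f_2 = x_1y_1 + x_2y_2 + x_3y_3` with respect to `Π_1`. -/
theorem Y_biHamiltonian :
    ∀ (p : Fin 6 → ℝ) (i : Fin 6),
      ![p 1, -p 0, 0, p 4, -p 3, 0] i
          = hamVF Pi0 (fun q => q 5) p i ∧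
      ![p 1, -p 0, 0, p 4, -p 3, 0] i
          = hamVF Pi1 (fun q => q 0 * q 3 + q 1 * q 4 + q 2 * q 5) p i := by
  intro p i
  simp only [hamVF, fderiv_coord_apply, fderiv_dot_apply, Fin.sum_univ_six]
  constructor <;> fin_cases i <;> simp [Pi0, Pi1] <;> ring
end
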